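/- arXiv:2310.00988 — 2 statements merged into one kernel-verified Lean document; each statement's English description precedes it below -/
import Mathlib

section
/- Assume 0 ≤ α < 1/2 and 0 < β < 1 (region T₂*). Then there exist M > 0 and functions λ₁, λ₃ : ℝ → ℂ such that for every μ > M, λ₁(μ), its complex conjugate, λ₃(μ), and its complex conjugate are roots of g(·, μ), and as μ → ∞: Re λ₁(μ) = −(1/8)μ^(2α+β−2)(1+o(1)), Im λ₁(μ) = √2 · μ^(1/2)(1+o(1)), Re λ₃(μ) = −(1/2)(1+o(1)), and Im λ₃(μ) = μ^(β/2)(1+o(1)). -/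
open Filter Real Topology

/-- Characteristic polynomial of the thermoelastic system with Cattaneo's law,
without inertial term (`m = 0`), with wave speed `σ = 2`, relaxation `τ = 1`:
`g(λ, μ) = λ⁴ + λ³ + (μ^(2α)+2μ+μ^β)λ² + (μ^(2α)+2μ)λ + 2μ^(1+β)`. -/
noncomputable def charPoly (α β μ : ℝ) (l : ℂ) : ℂ :=
  l ^ 4 + l ^ 3 +
    ((μ ^ (2 * α) + 2 * μ + μ ^ β : ℝ) : ℂ) * l ^ 2 +
    ((μ ^ (2 * α) + 2 * μ : ℝ) : ℂ) * l + ((2 * μ ^ (1 + β) : ℝ) : ℂ)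

/-- If `G i x → 1` as `i → l` and `x → 0`, then the equation `x * G i x = s i` with `s → 0⁺` has
solutions asymptotic to `s`. -/
theorem exists_solution_asymptotic {ι : Type*} {l : Filter ι} [l.NeBot] {G : ι → ℝ → ℝ} {s : ι → ℝ}
    (hs : ∀ᶠ i in l, 0 < s i) (hs0 : Tendsto s l (𝓝 0))
    (hc : ∀ᶠ i in l, ContinuousOn (G i) (Set.Icc 0 (2 * s i)))
    (hG : Tendsto (Function.uncurry G) (l ×ˢ 𝓝 0) (𝓝 1)) :
    ∃ a : ι → ℝ, (∀ᶠ i in l, a i * G i (a i) = s i) ∧ Tendsto a l (𝓝 0) ∧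
      Tendsto (fun i => a i / s i) l (𝓝 1) := by
  have hs2 : Tendsto (fun i => 2 * s i) l (𝓝 0) := by simpa using hs0.const_mul 2
  have hend : Tendsto (fun i => G i (2 * s i)) l (𝓝 1) := hG.comp (tendsto_id.prodMk hs2)
  have hex : ∀ᶠ i in l, ∃ x ∈ Set.Icc 0 (2 * s i), x * G i x = s i := by
    filter_upwards [hs, hc, hend.eventually_const_lt (show (1 / 2 : ℝ) < 1 by norm_num)]
      with i hi hci hei
    refine intermediate_value_Icc (by linarith : (0 : ℝ) ≤ 2 * s i)
      (continuousOn_id.mul hci) ⟨by simpa using hi.le, ?_⟩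
    dsimp
    nlinarith
  obtain ⟨a, ha⟩ := hex.choice
  have ha0 : Tendsto a l (𝓝 0) :=
    tendsto_of_tendsto_of_tendsto_of_le_of_le' tendsto_const_nhds hs2
      (ha.mono fun i hi => hi.1.1) (ha.mono fun i hi => hi.1.2)
  have hGa : Tendsto (fun i => G i (a i)) l (𝓝 1) := hG.comp (tendsto_id.prodMk ha0)
  refine ⟨a, ha.mono fun i hi => hi.2, ha0, ?_⟩
  have hinv : Tendsto (fun i => (G i (a i))⁻¹) l (𝓝 1) := by
    simpa using hGa.inv₀ one_ne_zero
  refine hinv.congr' ?_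
  filter_upwards [ha, hs] with i hi hsi
  have hne : a i * G i (a i) ≠ 0 := hi.2 ▸ hsi.ne'
  have hl := left_ne_zero_of_mul hne
  have hr := right_ne_zero_of_mul hne
  rw [← hi.2]
  field_simp

theorem charPoly_eq_mul {α β μ a b c d : ℝ} (hac : a + c = 1)
    (h2 : b + d + a * c = μ ^ (2 * α) + 2 * μ + μ ^ β)
    (h1 : a * d + b * c = μ ^ (2 * α) + 2 * μ) (h0 : b * d = 2 * μ ^ (1 + β)) (z : ℂ) :
    charPoly α β μ z = (z ^ 2 + a * z + b) * (z ^ 2 + c * z + d) := by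
  have hac' : (a : ℂ) + c = 1 := by exact_mod_cast hac
  rw [charPoly, ← h2, ← h1, ← h0]
  push_cast
  linear_combination (-z ^ 3) * hac'

/-- The root in the closed upper half plane of a real monic quadratic with nonpositive
discriminant. -/
noncomputable def upperRoot (a b : ℝ) : ℂ := ⟨-a / 2, √(b - a ^ 2 / 4)⟩

theorem upperRoot_isRoot {a b : ℝ} (h : a ^ 2 / 4 ≤ b) :
    upperRoot a b ^ 2 + a * upperRoot a b + b = 0 := by
  have hs := Real.mul_self_sqrt (sub_nonneg.2 h)
  rw [pow_two] at hs h
  apply Complex.ext <;> simp [upperRoot, pow_two] <;> nlinarith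

theorem conj_upperRoot_isRoot {a b : ℝ} (h : a ^ 2 / 4 ≤ b) :
    (starRingEnd ℂ) (upperRoot a b) ^ 2 + a * (starRingEnd ℂ) (upperRoot a b) + b = 0 := by
  simpa using congrArg (starRingEnd ℂ) (upperRoot_isRoot h)

/-- The difference of the constant terms in a factorization of the rescaled quartic into
real quadratics, as a function of the linear coefficient `a` of the first factor. Here
`r = μ ^ (2 * α) / (2 * μ)`, `q = μ ^ β / (2 * μ)` and `e = 1 / (2 * μ)`. -/
noncomputable def gap (r q e a : ℝ) : ℝ := (1 + r - q + e * (a * (1 - a))) / (1 - 2 * a)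

/-- The linear coefficient `a` of the first quadratic factor solves `a * factorEq r q e a = r * q`,
in the notation of `gap`. -/
noncomputable def factorEq (r q e a : ℝ) : ℝ :=
  (1 + r) * gap r q e a + e * ((1 + r) * (1 - a)) - q * gap r q e a + a * gap r q e a ^ 2 +
    e * (a * (1 - a)) * gap r q e a

theorem tendsto_gap {ι : Type*} {l : Filter ι} {r q e a : ι → ℝ} (hr : Tendsto r l (𝓝 0))
    (hq : Tendsto q l (𝓝 0)) (he : Tendsto e l (𝓝 0)) (ha : Tendsto a l (𝓝 0)) :
    Tendsto (fun i => gap (r i) (q i) (e i) (a i)) l (𝓝 1) := by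
  have h := ((((hr.const_add 1).sub hq).add (he.mul (ha.mul (ha.const_sub 1)))).div
    ((ha.const_mul 2).const_sub 1) (by norm_num))
  simpa [gap, Pi.div_def] using h

theorem tendsto_factorEq {ι : Type*} {l : Filter ι} {r q e a : ι → ℝ} (hr : Tendsto r l (𝓝 0))
    (hq : Tendsto q l (𝓝 0)) (he : Tendsto e l (𝓝 0)) (ha : Tendsto a l (𝓝 0)) :
    Tendsto (fun i => factorEq (r i) (q i) (e i) (a i)) l (𝓝 1) := by
  have hg := tendsto_gap hr hq he ha
  have h1 := hr.const_add 1
  have h := ((((h1.mul hg).add (he.mul (h1.mul (ha.const_sub 1)))).sub (hq.mul hg)).add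
    (ha.mul (hg.pow 2))).add ((he.mul (ha.mul (ha.const_sub 1))).mul hg)
  simpa [factorEq] using h

theorem continuousOn_factorEq (r q e : ℝ) :
    ContinuousOn (factorEq r q e) (Set.Iio (1 / 2)) := by
  have hg : ContinuousOn (gap r q e) (Set.Iio (1 / 2)) := by
    unfold gap
    refine ContinuousOn.div (by fun_prop) (by fun_prop) fun x hx => ?_
    have : x < 1 / 2 := hx
    linarith
  unfold factorEq
  fun_prop

theorem charPoly_roots_T2_star (α β : ℝ)
    (h1 : 0 ≤ α) (h2 : α < 1 / 2) (h3 : 0 < β) (h4 : β < 1) :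
    ∃ M > (0 : ℝ), ∃ l1 l3 : ℝ → ℂ,
      (∀ μ > M,
        charPoly α β μ (l1 μ) = 0 ∧ charPoly α β μ ((starRingEnd ℂ) (l1 μ)) = 0 ∧
        charPoly α β μ (l3 μ) = 0 ∧ charPoly α β μ ((starRingEnd ℂ) (l3 μ)) = 0) ∧
      Tendsto (fun μ : ℝ => (l1 μ).re / (-(1 / 8) * μ ^ (2 * α + β - 2))) atTop (𝓝 1) ∧
      Tendsto (fun μ : ℝ => (l1 μ).im / (Real.sqrt 2 * μ ^ ((1 : ℝ) / 2))) atTop (𝓝 1) ∧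
      Tendsto (fun μ : ℝ => (l3 μ).re / (-(1 / 2) : ℝ)) atTop (𝓝 1) ∧
      Tendsto (fun μ : ℝ => (l3 μ).im / (μ ^ (β / 2))) atTop (𝓝 1) := by
  set r : ℝ → ℝ := fun μ => μ ^ (2 * α) / (2 * μ) with hr
  set q : ℝ → ℝ := fun μ => μ ^ β / (2 * μ) with hq
  set e : ℝ → ℝ := fun μ => 1 / (2 * μ) with he
  have hpow : ∀ s < (1 : ℝ), Tendsto (fun μ : ℝ => μ ^ s / (2 * μ)) atTop (𝓝 0) := by
    intro s hs
    have h := (tendsto_rpow_neg_atTop (sub_pos.2 hs)).const_mul (1 / 2)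
    rw [mul_zero] at h
    refine h.congr' ?_
    filter_upwards [eventually_gt_atTop 0] with μ hμ
    rw [neg_sub, Real.rpow_sub_one hμ.ne']
    field_simp
  have hr0 : Tendsto r atTop (𝓝 0) := hpow _ (by linarith)
  have hq0 : Tendsto q atTop (𝓝 0) := hpow _ h4
  have he0 : Tendsto e atTop (𝓝 0) := by simpa [he] using hpow 0 one_pos
  have hQinv : Tendsto (fun μ : ℝ => (μ ^ β)⁻¹) atTop (𝓝 0) :=
    (tendsto_rpow_atTop h3).inv_tendsto_atTop
  have hs0 : Tendsto (fun μ => r μ * q μ) atTop (𝓝 0) := by simpa using hr0.mul hq0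
  obtain ⟨a, ha, ha0, has⟩ := exists_solution_asymptotic (l := atTop)
    (G := fun μ => factorEq (r μ) (q μ) (e μ)) (s := fun μ => r μ * q μ)
    (by filter_upwards [eventually_gt_atTop 0] with μ hμ; positivity) hs0
    (by
      filter_upwards [hs0.eventually_lt_const (show (0 : ℝ) < 1 / 4 by norm_num)] with μ hμ
      refine (continuousOn_factorEq _ _ _).mono fun x hx => ?_
      have := hx.2
      simp only [Set.mem_Iio]
      linarith)
    (tendsto_factorEq (hr0.comp tendsto_fst) (hq0.comp tendsto_fst) (he0.comp tendsto_fst)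
      tendsto_snd)
  set δ : ℝ → ℝ := fun μ => gap (r μ) (q μ) (e μ) (a μ) with hδ
  have hδ1 : Tendsto δ atTop (𝓝 1) := tendsto_gap hr0 hq0 he0 ha0
  set b : ℝ → ℝ := fun μ => 2 * μ * (1 + r μ + a μ * δ μ) with hb
  set d : ℝ → ℝ := fun μ => μ ^ β - a μ * (2 * μ * δ μ) - a μ * (1 - a μ) with hd
  have hb1 : Tendsto (fun μ => (b μ - a μ ^ 2 / 4) / (2 * μ)) atTop (𝓝 1) := by
    have h := ((hr0.const_add 1).add (ha0.mul hδ1)).sub (((ha0.pow 2).div_const 4).mul he0)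
    norm_num at h
    refine h.congr' ?_
    filter_upwards [eventually_gt_atTop 0] with μ hμ
    simp only [hb, he]
    field_simp
  have hd1 : Tendsto (fun μ => (d μ - (1 - a μ) ^ 2 / 4) / μ ^ β) atTop (𝓝 1) := by
    have h := (((has.mul (hr0.mul hδ1)).const_sub 1).sub
      ((ha0.mul (ha0.const_sub 1)).mul hQinv)).sub
      ((((ha0.const_sub 1).pow 2).div_const 4).mul hQinv)
    norm_num at h
    refine h.congr' ?_
    filter_upwards [eventually_gt_atTop 0] with μ hμ
    have hQ : (0 : ℝ) < μ ^ β := by positivity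
    have hR : (0 : ℝ) < μ ^ (2 * α) := by positivity
    simp only [hd, hr, hq]
    field_simp
  have hroots : ∀ᶠ μ in atTop,
      charPoly α β μ (upperRoot (a μ) (b μ)) = 0 ∧
      charPoly α β μ ((starRingEnd ℂ) (upperRoot (a μ) (b μ))) = 0 ∧
      charPoly α β μ (upperRoot (1 - a μ) (d μ)) = 0 ∧
      charPoly α β μ ((starRingEnd ℂ) (upperRoot (1 - a μ) (d μ))) = 0 := by
    filter_upwards [eventually_gt_atTop 0, ha, hb1.eventually_const_lt one_pos,
      hd1.eventually_const_lt one_pos,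
      ha0.eventually_lt_const (show (0 : ℝ) < 1 / 4 by norm_num)] with μ hμ haμ hbμ hdμ hsmall
    have hQ : (0 : ℝ) < μ ^ β := by positivity
    have hbd : a μ ^ 2 / 4 ≤ b μ := by
      rw [div_pos_iff_of_pos_right (by positivity)] at hbμ
      linarith
    have hdd : (1 - a μ) ^ 2 / 4 ≤ d μ := by
      rw [div_pos_iff_of_pos_right hQ] at hdμ
      linarith
    have hgap : δ μ * (1 - 2 * a μ) = 1 + r μ - q μ + e μ * (a μ * (1 - a μ)) :=
      div_mul_cancel₀ _ (by linarith)
    have hR' : 2 * μ * r μ = μ ^ (2 * α) := by simp only [hr]; field_simp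
    have hQ' : 2 * μ * q μ = μ ^ β := by simp only [hq]; field_simp
    have he' : 2 * μ * e μ = 1 := by simp only [he]; field_simp
    have heq : a μ * ((1 + r μ) * δ μ + e μ * ((1 + r μ) * (1 - a μ)) - q μ * δ μ +
      a μ * δ μ ^ 2 + e μ * (a μ * (1 - a μ)) * δ μ) = r μ * q μ := haμ
    have hfac := charPoly_eq_mul (α := α) (β := β) (μ := μ) (a := a μ) (b := b μ) (c := 1 - a μ)
      (d := d μ) (by ring)
      (by simp only [hb, hd]; linear_combination hR')
      (by
        simp only [hb, hd]
        rw [← hQ', ← hR']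
        linear_combination (2 * μ * a μ) * hgap + a μ ^ 2 * (1 - a μ) * he')
      (by
        simp only [hb, hd]
        rw [Real.rpow_add hμ, Real.rpow_one, ← hQ']
        linear_combination (-(2 * μ) ^ 2) * heq +
          (2 * μ * (1 + r μ + a μ * δ μ) * (a μ * (1 - a μ))) * he')
    simp only [hfac, upperRoot_isRoot hbd, conj_upperRoot_isRoot hbd]
    have h := upperRoot_isRoot hdd
    have h' := conj_upperRoot_isRoot hdd
    simp only [h, h', zero_mul, mul_zero, and_self]
  obtain ⟨M, hM⟩ := eventually_atTop.1 hroots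
  refine ⟨max M 1, by positivity, fun μ => upperRoot (a μ) (b μ),
    fun μ => upperRoot (1 - a μ) (d μ), fun μ hμ => hM μ ((le_max_left _ _).trans hμ.le),
    ?_, ?_, ?_, ?_⟩
  · refine has.congr' ?_
    filter_upwards [eventually_gt_atTop 0] with μ hμ
    have hQ : (0 : ℝ) < μ ^ β := by positivity
    have hR : (0 : ℝ) < μ ^ (2 * α) := by positivity
    simp only [upperRoot, hr, hq]
    rw [Real.rpow_sub hμ, Real.rpow_add hμ, Real.rpow_two]
    field_simp
    norm_num
  · have h := hb1.sqrt
    rw [Real.sqrt_one] at h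
    refine h.congr' ?_
    filter_upwards [eventually_gt_atTop 0] with μ hμ
    rw [Real.sqrt_div' _ (by positivity), Real.sqrt_mul zero_le_two, ← Real.sqrt_eq_rpow]
    rfl
  · have h := ha0.const_sub 1
    rw [sub_zero] at h
    refine h.congr fun μ => ?_
    simp only [upperRoot]
    ring
  · have h := hd1.sqrt
    rw [Real.sqrt_one] at h
    refine h.congr' ?_
    filter_upwards [eventually_gt_atTop 0] with μ hμ
    rw [Real.sqrt_div' _ (by positivity), Real.sqrt_eq_rpow (μ ^ β), ← Real.rpow_mul hμ.le,
      mul_one_div]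
    rfl
end

section
/- Assume α = (β+1)/2 and 0 < β ≤ 1 (region F₁₄*). Then there exist M > 0 and functions λ₁, λ₃ : ℝ → ℂ such that for every μ > M, λ₁(μ), its complex conjugate, λ₃(μ), and its complex conjugate are roots of g(·, μ), and as μ → ∞: Re λ₁(μ) = −(1/2)μ^(−1)(1+o(1)), Im λ₁(μ) = μ^((β+1)/2)(1+o(1)), Re λ₃(μ) = −(1/2)(1+o(1)), and Im λ₃(μ) = (√7/2)(1+o(1)). -/
open Filter Real Topology

/-- The quartic `x⁴ + x³ + (s + 2μ + b)x² + (s + 2μ)x + 2s` with `s = μ b` splits into real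
quadratics `(x² + (1 - r)x + q)(x² + rx + t)` with `r` small and `t` close to `s`. -/
theorem exists_quadratic_factorization {μ s b : ℝ} (hμ : 4 ≤ μ) (hb : 2 ≤ b) (hs : s = μ * b) :
    ∃ r t q : ℝ, (0 ≤ r ∧ r ≤ 1 / μ) ∧ (s + 2 * μ - b ≤ t ∧ t * (1 - 2 / μ) ≤ s + 2 * μ) ∧
      q * t = 2 * s ∧ q + t + (1 - r) * r = s + 2 * μ + b ∧ (1 - r) * t + q * r = s + 2 * μ := by
  have hμ0 : 0 < μ := by linarith
  have hbs : 4 * b ≤ s := by rw [hs]; gcongr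
  set S := s + 2 * μ + b with hS
  have hS0 : 0 < S := by linarith
  set ρ := b / S with hρ
  have hρ0 : 0 ≤ ρ := by positivity
  have hρS : ρ * S = b := by rw [hρ]; field_simp
  have hρμ : ρ ≤ 1 / μ := by
    rw [hρ, div_le_div_iff₀ hS0 hμ0]
    nlinarith
  have hμ4 : 1 / μ ≤ 1 / 4 := one_div_le_one_div_of_le (by norm_num) hμ
  let A : ℝ → ℝ := fun r => S - r * (1 - r)
  let T : ℝ → ℝ := fun r => (s + 2 * μ - r * A r) / (1 - 2 * r)
  have hA : ∀ r ∈ Set.Icc 0 ρ, 0 ≤ r * A r ∧ r * A r ≤ b := by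
    rintro r ⟨hr0, hr1⟩
    have h1 : r * (1 - r) ≤ 1 := by nlinarith
    have h2 : 0 ≤ r * (1 - r) := mul_nonneg hr0 (by linarith)
    refine ⟨mul_nonneg hr0 (by simp only [A]; linarith), ?_⟩
    calc r * A r ≤ r * S := by
          gcongr
          simp only [A]
          linarith
      _ ≤ ρ * S := by gcongr
      _ = b := hρS
  have hT : ∀ r ∈ Set.Icc 0 ρ, T r * (1 - 2 * r) = s + 2 * μ - r * A r := by
    rintro r ⟨hr0, hr1⟩
    exact div_mul_cancel₀ _ (by linarith)
  have hTlow : ∀ r ∈ Set.Icc 0 ρ, s + 2 * μ - b ≤ T r := by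
    intro r hr
    have h1 := hA r hr
    have h2 : 0 < 1 - 2 * r := by linarith [hr.2]
    rw [le_div_iff₀ h2]
    nlinarith [hr.1]
  have hcont : ContinuousOn (fun r => (A r - T r) * T r) (Set.Icc 0 ρ) := by
    have hAc : Continuous A := by fun_prop
    have hTc : ContinuousOn T (Set.Icc 0 ρ) := by
      refine ContinuousOn.div (by fun_prop) (by fun_prop) ?_
      rintro r ⟨-, hr⟩
      linarith
    exact (hAc.continuousOn.sub hTc).mul hTc
  have h0 : 2 * s ≤ (A 0 - T 0) * T 0 := by
    simp only [A, T, hS]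
    norm_num
    nlinarith
  have hend : (A ρ - T ρ) * T ρ ≤ 2 * s := by
    have hmem : ρ ∈ Set.Icc 0 ρ := ⟨hρ0, le_rfl⟩
    have h1 := hTlow ρ hmem
    have h2 := hT ρ hmem
    have h3 : (A ρ - T ρ) * (1 - 2 * ρ) = - (ρ * (1 - ρ) ^ 2) := by
      rw [sub_mul, h2]
      simp only [A]
      linear_combination hS - hρS
    have h4 : A ρ - T ρ ≤ 0 := by
      have : 0 ≤ ρ * (1 - ρ) ^ 2 := by positivity
      have h5 : 0 < 1 - 2 * ρ := by linarith
      by_contra! h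
      nlinarith [mul_pos h h5]
    nlinarith
  obtain ⟨r, hr, hr'⟩ := intermediate_value_Icc' hρ0 hcont ⟨hend, h0⟩
  refine ⟨r, T r, A r - T r, ⟨hr.1, hr.2.trans hρμ⟩, ⟨hTlow r hr, ?_⟩, hr', ?_, ?_⟩
  · have h1 := hTlow r hr
    have h2 : 2 / μ = 2 * (1 / μ) := by ring
    calc T r * (1 - 2 / μ) ≤ T r * (1 - 2 * r) := by
          have : 0 ≤ T r := by linarith
          gcongr
          linarith [hr.2]
      _ ≤ s + 2 * μ := by linarith [hT r hr, (hA r hr).1]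
  · simp only [A]
    ring
  · linear_combination hT r hr

theorem quadratic_root_of_neg_discrim {r t : ℝ} (h : r ^ 2 / 4 ≤ t) :
    (⟨-r / 2, √(t - r ^ 2 / 4)⟩ : ℂ) ^ 2 + r * ⟨-r / 2, √(t - r ^ 2 / 4)⟩ + t = 0 := by
  have hsq := Real.sq_sqrt (sub_nonneg.2 h)
  apply Complex.ext
  · simp only [pow_two] at hsq ⊢
    simp
    linarith
  · simp [pow_two]
    ring

theorem charPoly_conj (α β μ : ℝ) (l : ℂ) :
    charPoly α β μ ((starRingEnd ℂ) l) = (starRingEnd ℂ) (charPoly α β μ l) := by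
  simp only [charPoly, map_add, map_mul, map_pow, Complex.conj_ofReal]

theorem charPoly_eq_mul_s17 {α β μ r t q : ℝ} (hα : 2 * α = 1 + β)
    (h1 : q * t = 2 * μ ^ (1 + β)) (h2 : q + t + (1 - r) * r = μ ^ (1 + β) + 2 * μ + μ ^ β)
    (h3 : (1 - r) * t + q * r = μ ^ (1 + β) + 2 * μ) (l : ℂ) :
    charPoly α β μ l = (l ^ 2 + (1 - r : ℝ) * l + q) * (l ^ 2 + r * l + t) := by
  rw [charPoly, hα, ← h1, ← h2, ← h3]
  push_cast
  ring

theorem charPoly_roots_F14_star (α β : ℝ)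
    (h1 : α = (β + 1) / 2) (h2 : 0 < β) (h3 : β ≤ 1) :
    ∃ M > (0 : ℝ), ∃ l1 l3 : ℝ → ℂ,
      (∀ μ > M,
        charPoly α β μ (l1 μ) = 0 ∧ charPoly α β μ ((starRingEnd ℂ) (l1 μ)) = 0 ∧
        charPoly α β μ (l3 μ) = 0 ∧ charPoly α β μ ((starRingEnd ℂ) (l3 μ)) = 0) ∧
      Tendsto (fun μ : ℝ => (l1 μ).re / (-(1 / 2) * μ ^ (-1 : ℝ))) atTop (𝓝 1) ∧
      Tendsto (fun μ : ℝ => (l1 μ).im / (μ ^ ((β + 1) / 2))) atTop (𝓝 1) ∧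
      Tendsto (fun μ : ℝ => (l3 μ).re / (-(1 / 2) : ℝ)) atTop (𝓝 1) ∧
      Tendsto (fun μ : ℝ => (l3 μ).im / (Real.sqrt 7 / 2 : ℝ)) atTop (𝓝 1) := by
  have hb : Tendsto (fun μ : ℝ => μ ^ β) atTop atTop := tendsto_rpow_atTop h2
  have hs : Tendsto (fun μ : ℝ => μ ^ (1 + β)) atTop atTop := tendsto_rpow_atTop (by linarith)
  have hsb : ∀ μ : ℝ, 4 ≤ μ → μ ^ (1 + β) = μ * μ ^ β := fun μ hμ => by
    rw [rpow_add (by linarith), rpow_one]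
  have hex : ∀ᶠ μ : ℝ in atTop, ∃ v : ℝ × ℝ × ℝ, (0 ≤ v.1 ∧ v.1 ≤ 1 / μ) ∧
      (μ ^ (1 + β) + 2 * μ - μ ^ β ≤ v.2.1 ∧ v.2.1 * (1 - 2 / μ) ≤ μ ^ (1 + β) + 2 * μ) ∧
      v.2.2 * v.2.1 = 2 * μ ^ (1 + β) ∧
      v.2.2 + v.2.1 + (1 - v.1) * v.1 = μ ^ (1 + β) + 2 * μ + μ ^ β ∧
      (1 - v.1) * v.2.1 + v.2.2 * v.1 = μ ^ (1 + β) + 2 * μ := by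
    filter_upwards [eventually_ge_atTop 4, hb.eventually_ge_atTop 2] with μ hμ hbμ
    obtain ⟨r, t, q, h⟩ := exists_quadratic_factorization hμ hbμ (hsb μ hμ)
    exact ⟨(r, t, q), h⟩
  obtain ⟨v, hv⟩ := hex.choice
  obtain ⟨r, hr⟩ : ∃ r : ℝ → ℝ, r = fun μ => (v μ).1 := ⟨_, rfl⟩
  obtain ⟨t, ht⟩ : ∃ t : ℝ → ℝ, t = fun μ => (v μ).2.1 := ⟨_, rfl⟩
  obtain ⟨q, hq⟩ : ∃ q : ℝ → ℝ, q = fun μ => (v μ).2.2 := ⟨_, rfl⟩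
  replace hv : ∀ᶠ μ : ℝ in atTop, (0 ≤ r μ ∧ r μ ≤ 1 / μ) ∧
      (μ ^ (1 + β) + 2 * μ - μ ^ β ≤ t μ ∧ t μ * (1 - 2 / μ) ≤ μ ^ (1 + β) + 2 * μ) ∧
      q μ * t μ = 2 * μ ^ (1 + β) ∧
      q μ + t μ + (1 - r μ) * r μ = μ ^ (1 + β) + 2 * μ + μ ^ β ∧
      (1 - r μ) * t μ + q μ * r μ = μ ^ (1 + β) + 2 * μ := by
    subst hr ht hq
    exact hv
  clear hr ht hq hex
  have hinv : Tendsto (fun μ : ℝ => 1 / μ) atTop (𝓝 0) := by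
    simpa using tendsto_inv_atTop_zero (𝕜 := ℝ)
  have hbinv : Tendsto (fun μ : ℝ => 1 / μ ^ β) atTop (𝓝 0) := by
    simpa only [one_div] using! hb.inv_tendsto_atTop
  have hsinv : Tendsto (fun μ : ℝ => 1 / μ ^ (1 + β)) atTop (𝓝 0) := by
    simpa only [one_div] using! hs.inv_tendsto_atTop
  have hr : Tendsto r atTop (𝓝 0) :=
    tendsto_of_tendsto_of_tendsto_of_le_of_le' tendsto_const_nhds hinv
      (hv.mono fun μ h => h.1.1) (hv.mono fun μ h => h.1.2)
  have htlim : Tendsto (fun μ => t μ / μ ^ (1 + β)) atTop (𝓝 1) := by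
    have hlow : Tendsto (fun μ : ℝ => 1 + 2 * (1 / μ ^ β) - 1 / μ) atTop (𝓝 1) := by
      simpa using ((hbinv.const_mul 2).const_add 1).sub hinv
    have hhigh : Tendsto (fun μ : ℝ => (1 + 2 * (1 / μ ^ β)) / (1 - 2 * (1 / μ))) atTop (𝓝 1) := by
      have h := ((hbinv.const_mul 2).const_add 1).div ((hinv.const_mul 2).const_sub 1)
        (by norm_num)
      norm_num only at h
      exact h
    refine tendsto_of_tendsto_of_tendsto_of_le_of_le' hlow hhigh ?_ ?_
    · filter_upwards [hv, eventually_ge_atTop 4] with μ h hμ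
      have hμ0 : 0 < μ := by linarith
      have hb0 : 0 < μ ^ β := rpow_pos_of_pos hμ0 β
      rw [hsb μ hμ] at h ⊢
      rw [le_div_iff₀ (by positivity)]
      refine le_trans (le_of_eq ?_) h.2.1.1
      field_simp
    · filter_upwards [hv, eventually_ge_atTop 4] with μ h hμ
      have hμ0 : 0 < μ := by linarith
      have hb0 : 0 < μ ^ β := rpow_pos_of_pos hμ0 β
      have hμ4 : 1 / μ ≤ 1 / 4 := one_div_le_one_div_of_le (by norm_num) hμ
      rw [hsb μ hμ] at h ⊢
      rw [div_le_div_iff₀ (by positivity) (by linarith)]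
      calc t μ * (1 - 2 * (1 / μ)) = t μ * (1 - 2 / μ) := by ring
        _ ≤ _ := h.2.1.2
        _ = _ := by field_simp
  have hqlim : Tendsto q atTop (𝓝 2) := by
    have h := (tendsto_const_nhds (x := (2 : ℝ))).div htlim one_ne_zero
    rw [div_one] at h
    refine h.congr' ?_
    filter_upwards [hv, hs.eventually_gt_atTop 0] with μ h hs0
    have ht0 : t μ ≠ 0 := fun h0 => by
      have := h.2.2.1
      rw [h0] at this
      linarith
    simp only [Pi.div_apply]
    rw [div_div_eq_mul_div, ← h.2.2.1, mul_div_cancel_right₀ _ ht0]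
  have hrlim : Tendsto (fun μ => μ * r μ) atTop (𝓝 1) := by
    have h := (((hr.const_sub 1).mul (hqlim.mul hbinv)).const_sub 1).div
      (htlim.add ((hr.const_sub 1).mul hsinv)) (by norm_num)
    norm_num only at h
    refine h.congr' ?_
    filter_upwards [hv, eventually_ge_atTop 4] with μ h hμ
    have hμ0 : 0 < μ := by linarith
    have hb0 : 0 < μ ^ β := rpow_pos_of_pos hμ0 β
    have hμ4 : 1 / μ ≤ 1 / 4 := one_div_le_one_div_of_le (by norm_num) hμ
    rw [Pi.div_apply, hsb μ hμ]
    rw [hsb μ hμ] at h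
    obtain ⟨⟨-, h1'⟩, ⟨h2, -⟩, -, h4, h5⟩ := h
    have hpos : 0 < t μ + (1 - r μ) := by nlinarith
    have hden : t μ / (μ * μ ^ β) + (1 - r μ) * (1 / (μ * μ ^ β)) =
        (t μ + (1 - r μ)) / (μ * μ ^ β) := by ring
    rw [hden, div_eq_iff (by positivity)]
    field_simp
    linear_combination h5 - h4
  have hdisc₁ : Tendsto (fun μ => (t μ - r μ ^ 2 / 4) / μ ^ (1 + β)) atTop (𝓝 1) := by
    have h := htlim.sub (((hr.pow 2).div_const 4).mul hsinv)
    norm_num at h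
    exact h.congr fun μ => by ring
  have hdisc₃ : Tendsto (fun μ => q μ - (1 - r μ) ^ 2 / 4) atTop (𝓝 (7 / 4)) := by
    have h := hqlim.sub (((hr.const_sub 1).pow 2).div_const 4)
    norm_num at h
    exact h
  have hev : ∀ᶠ μ in atTop, charPoly α β μ ⟨-r μ / 2, √(t μ - r μ ^ 2 / 4)⟩ = 0 ∧
      charPoly α β μ ⟨-(1 - r μ) / 2, √(q μ - (1 - r μ) ^ 2 / 4)⟩ = 0 := by
    filter_upwards [hv, hs.eventually_gt_atTop 0, hdisc₁.eventually_const_lt zero_lt_one,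
      hdisc₃.eventually_const_lt (show (0 : ℝ) < 7 / 4 by norm_num)] with μ h hs0 hd₁ hd₃
    have hd₁' : 0 < t μ - r μ ^ 2 / 4 := (div_pos_iff_of_pos_right hs0).1 hd₁
    have hfac := charPoly_eq_mul_s17 (α := α) (by rw [h1]; ring) h.2.2.1 h.2.2.2.1 h.2.2.2.2
    exact ⟨by rw [hfac, quadratic_root_of_neg_discrim (sub_pos.1 hd₁').le, mul_zero],
      by rw [hfac, quadratic_root_of_neg_discrim (sub_pos.1 hd₃).le, zero_mul]⟩
  obtain ⟨M, hM⟩ := eventually_atTop.1 hev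
  refine ⟨max M 1, by positivity, fun μ => ⟨-r μ / 2, √(t μ - r μ ^ 2 / 4)⟩,
    fun μ => ⟨-(1 - r μ) / 2, √(q μ - (1 - r μ) ^ 2 / 4)⟩, fun μ hμ => ?_, ?_, ?_, ?_, ?_⟩
  · obtain ⟨h₁, h₃⟩ := hM μ ((le_max_left _ _).trans hμ.le)
    refine ⟨h₁, ?_, h₃, ?_⟩
    · rw [charPoly_conj, h₁, map_zero]
    · rw [charPoly_conj, h₃, map_zero]
  · refine hrlim.congr' ?_
    filter_upwards [eventually_gt_atTop 0] with μ hμ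
    rw [rpow_neg_one]
    field_simp
  · have h := hdisc₁.sqrt
    rw [Real.sqrt_one] at h
    refine h.congr' ?_
    filter_upwards [eventually_gt_atTop 0] with μ hμ
    rw [Real.sqrt_div' _ (rpow_nonneg hμ.le _), Real.sqrt_eq_rpow (μ ^ (1 + β)), ← rpow_mul hμ.le]
    congr 2
    ring
  · have h := ((hr.const_sub 1).neg.div_const 2).div_const (-(1 / 2))
    norm_num at h
    norm_num
    exact h
  · have h := hdisc₃.sqrt.div_const (√7 / 2)
    have h74 : √(7 / 4 : ℝ) = √7 / 2 := by
      rw [Real.sqrt_div (by norm_num), show (4 : ℝ) = 2 ^ 2 by norm_num,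
        Real.sqrt_sq (by norm_num)]
    rwa [h74, div_self (by positivity)] at h
end
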